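/- arXiv:2109.00487 — 2 statements merged into one kernel-verified Lean document; each statement's English description precedes it below -/
import Mathlib

section
/- In a standard one-dimensional screening problem, suppose additionally that v(x, θ) is Lipschitz continuous on X × Θ. Let V(Θ, μ) denote the supremum of the principal's payoff over all measurable IC and IR mechanisms with bounded transfer. Then there exists a sequence {(Θ^(n), μ^(n))} with each Θ^(n) ⊆ Θ finite and each μ^(n) a full-support probability measure on Θ^(n), such that (i) μ^(n) converges weakly to μ (as measures on Θ), and (ii) limsup_{n→∞} V(Θ^(n), μ^(n)) ≤ V(Θ, μ), where V(Θ^(n), μ^(n)) is the optimal value of the same screening problem with type space Θ^(n) and type distribution μ^(n). -/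
open MeasureTheory Set Filter

noncomputable section

/-- A measurable IC and IR mechanism with bounded transfer, for the screening
problem with type space `Θ'`. -/
def ICIRMech (Θ' X : Set ℝ) (u : ℝ → ℝ → ℝ) (x t : ℝ → ℝ) : Prop :=
  Measurable x ∧ Measurable t ∧ (∃ K : ℝ, ∀ a, |t a| ≤ K) ∧
    (∀ a ∈ Θ', x a ∈ X) ∧
    (∀ a ∈ Θ', ∀ a' ∈ Θ', u (x a) a - t a ≥ u (x a') a - t a') ∧
    (∀ a ∈ Θ', u (x a) a - t a ≥ 0)

/-- `V Θ' μ'`: the supremum of the principal's payoff over measurable IC and IR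
mechanisms with bounded transfer, for type space `Θ'` and type distribution `μ'`. -/
def V (X : Set ℝ) (u v : ℝ → ℝ → ℝ) (Θ' : Set ℝ) (μ' : Measure ℝ) : ℝ :=
  sSup {p : ℝ | ∃ x t : ℝ → ℝ, ICIRMech Θ' X u x t ∧
    p = ∫ a, (v (x a) a + t a) ∂μ'}

open Topology

/-- Diagonal extraction: a bounded sequence of functions has a subsequence converging at every
point of a countable set. -/
lemma exists_subseq_tendsto_on_countable {α : Type*} {S : Set α} (hS : S.Countable)
    {f : ℕ → α → ℝ} {M : ℝ} (hf : ∀ n a, |f n a| ≤ M) :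
    ∃ φ : ℕ → ℕ, StrictMono φ ∧
      ∀ a ∈ S, ∃ l, Tendsto (fun n => f (φ n) a) atTop (𝓝 l) := by
  have : Countable S := hS.to_subtype
  have hc : IsCompact (Set.pi univ fun _ : S => Icc (-M) M) :=
    isCompact_univ_pi fun _ => isCompact_Icc
  obtain ⟨l, -, φ, hφ, hl⟩ := hc.isSeqCompact (x := fun n (a : S) => f n a)
    fun n a _ => abs_le.mp (hf n a)
  exact ⟨φ, hφ, fun a ha => ⟨l ⟨a, ha⟩, (tendsto_pi_nhds.mp hl) ⟨a, ha⟩⟩⟩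

/-- **Helly's selection theorem** for monotone functions on the line. -/
lemma exists_subseq_tendsto_of_monotone {f : ℕ → ℝ → ℝ} {M : ℝ} (hmono : ∀ n, Monotone (f n))
    (hf : ∀ n a, |f n a| ≤ M) :
    ∃ φ : ℕ → ℕ, StrictMono φ ∧ ∀ a, ∃ l, Tendsto (fun n => f (φ n) a) atTop (𝓝 l) := by
  obtain ⟨φ, hφ, hφl⟩ := exists_subseq_tendsto_on_countable
    (countable_range ((↑) : ℚ → ℝ)) hf
  have hub (a : ℝ) : IsBoundedUnder (· ≤ ·) atTop fun n => f (φ n) a :=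
    isBoundedUnder_of ⟨M, fun n => (abs_le.mp (hf _ a)).2⟩
  have hlb (a : ℝ) : IsBoundedUnder (· ≥ ·) atTop fun n => f (φ n) a :=
    isBoundedUnder_of ⟨-M, fun n => (abs_le.mp (hf _ a)).1⟩
  set g : ℝ → ℝ := fun a => liminf (fun n => f (φ n) a) atTop with hg
  have hgmono : Monotone g := fun a b hab =>
    liminf_le_liminf (.of_forall fun n => hmono _ hab) (hlb a) (hub b).isCoboundedUnder_ge
  have hcont (a : ℝ) (ha : ContinuousAt g a) :
      Tendsto (fun n => f (φ n) a) atTop (𝓝 (g a)) := by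
    refine tendsto_of_le_liminf_of_limsup_le le_rfl ?_ (hub a) (hlb a)
    refine le_of_forall_pos_le_add fun ε hε => ?_
    obtain ⟨δ, hδ, hball⟩ := Metric.continuousAt_iff.mp ha ε hε
    obtain ⟨q, hq, hq'⟩ := exists_rat_btwn (lt_add_of_pos_right a hδ)
    obtain ⟨l, hl⟩ := hφl q ⟨q, rfl⟩
    have hgq : dist (g q) (g a) < ε :=
      hball (by rw [Real.dist_eq, abs_of_pos (by linarith)]; linarith)
    rw [Real.dist_eq] at hgq
    calc limsup (fun n => f (φ n) a) atTop ≤ limsup (fun n => f (φ n) q) atTop :=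
          limsup_le_limsup (.of_forall fun n => hmono _ hq.le) (hlb a).isCoboundedUnder_le (hub q)
      _ = g q := by rw [hl.limsup_eq, hg]; exact hl.liminf_eq.symm
      _ ≤ g a + ε := by linarith [(abs_lt.mp hgq).2]
  obtain ⟨ψ, hψ, hψl⟩ := exists_subseq_tendsto_on_countable hgmono.countable_not_continuousAt
    (f := fun n => f (φ n)) fun n => hf (φ n)
  refine ⟨φ ∘ ψ, hφ.comp hψ, fun a => ?_⟩
  by_cases ha : ContinuousAt g a
  · exact ⟨g a, (hcont a ha).comp hψ.tendsto_atTop⟩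
  · exact hψl a ha

lemma exists_subseq_tendsto_of_monotoneOn {S : Set ℝ} {f : ℕ → ℝ → ℝ} {M : ℝ}
    (hmono : ∀ n, MonotoneOn (f n) S) (hf : ∀ n, ∀ a ∈ S, |f n a| ≤ M) :
    ∃ φ : ℕ → ℕ, StrictMono φ ∧
      ∀ a ∈ S, ∃ l, Tendsto (fun n => f (φ n) a) atTop (𝓝 l) := by
  have hext (n : ℕ) : ∃ g : ℝ → ℝ, Monotone g ∧ EqOn (f n) g S := by
    refine (hmono n).exists_monotone_extension ⟨-M, ?_⟩ ⟨M, ?_⟩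
    · rintro _ ⟨a, ha, rfl⟩
      exact (abs_le.mp (hf n a ha)).1
    · rintro _ ⟨a, ha, rfl⟩
      exact (abs_le.mp (hf n a ha)).2
  choose g hgmono hg using hext
  obtain ⟨φ, hφ, hφl⟩ := exists_subseq_tendsto_of_monotone
    (f := fun n a => max (-|M|) (min |M| (g n a))) (M := |M|)
    (fun n a b hab => max_le_max le_rfl (min_le_min le_rfl (hgmono n hab)))
    (fun n a => abs_le.mpr
      ⟨le_max_left _ _, max_le (neg_le_self (abs_nonneg M)) (min_le_left _ _)⟩)
  refine ⟨φ, hφ, fun a ha => ?_⟩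
  obtain ⟨l, hl⟩ := hφl a
  refine ⟨l, hl.congr fun n => ?_⟩
  have h := abs_le.mp ((hf (φ n) a ha).trans (le_abs_self M))
  rw [← hg (φ n) ha, min_eq_right h.2, max_eq_right h.1]

lemma tendsto_of_continuousOn_prod {w : ℝ → ℝ → ℝ} {X Θ : Set ℝ}
    (hw : ContinuousOn (fun p : ℝ × ℝ => w p.1 p.2) (X ×ˢ Θ)) {x a : ℕ → ℝ} {x' a' : ℝ}
    (hx : Tendsto x atTop (𝓝 x')) (ha : Tendsto a atTop (𝓝 a')) (hxX : ∀ n, x n ∈ X)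
    (haΘ : ∀ n, a n ∈ Θ) (hx' : x' ∈ X) (ha' : a' ∈ Θ) :
    Tendsto (fun n => w (x n) (a n)) atTop (𝓝 (w x' a')) :=
  (hw (x', a') ⟨hx', ha'⟩).tendsto.comp <| tendsto_nhdsWithin_iff.mpr
    ⟨hx.prodMk_nhds ha, .of_forall fun n => ⟨hxX n, haΘ n⟩⟩

section Mechanism

variable {Θ X : Set ℝ} {u v : ℝ → ℝ → ℝ}

lemma ICIRMech.monotoneOn_allocation {Θ' : Set ℝ} {x t : ℝ → ℝ} (h : ICIRMech Θ' X u x t)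
    (hΘ' : Θ' ⊆ Θ)
    (hSID : ∀ x ∈ X, ∀ x' ∈ X, x < x' → ∀ a ∈ Θ, ∀ a' ∈ Θ, a < a' →
      u x' a - u x a < u x' a' - u x a') :
    MonotoneOn x Θ' := by
  obtain ⟨-, -, -, hxX, hIC, -⟩ := h
  intro a ha a' ha' haa'
  rcases haa'.eq_or_lt with rfl | hlt
  · exact le_rfl
  by_contra! hx
  linarith [hSID _ (hxX a' ha') _ (hxX a ha) hx a (hΘ' ha) a' (hΘ' ha') hlt,
    hIC a ha a' ha', hIC a' ha' a ha]

lemma ICIRMech.monotoneOn_rent {Θ' : Set ℝ} {x t : ℝ → ℝ} (h : ICIRMech Θ' X u x t)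
    (hΘ' : Θ' ⊆ Θ)
    (humono : ∀ x ∈ X, ∀ a ∈ Θ, ∀ a' ∈ Θ, a ≤ a' → u x a ≤ u x a') :
    MonotoneOn (fun a => u (x a) a - t a) Θ' := by
  obtain ⟨-, -, -, hxX, hIC, -⟩ := h
  intro a ha a' ha' haa'
  linarith [hIC a' ha' a ha, humono _ (hxX a ha) a (hΘ' ha) a' (hΘ' ha') haa']

/-- Raising transfers uniformly until the participation constraint of the lowest type binds
keeps a mechanism admissible, and makes its transfers as bounded as the agent's utility. -/
lemma ICIRMech.exists_normalized {Θ' : Set ℝ} {x t : ℝ → ℝ} (h : ICIRMech Θ' X u x t)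
    (hΘ' : Θ' ⊆ Θ) {a₀ : ℝ} (ha₀ : IsLeast Θ' a₀)
    (humono : ∀ x ∈ X, ∀ a ∈ Θ, ∀ a' ∈ Θ, a ≤ a' → u x a ≤ u x a')
    {M : ℝ} (hM : ∀ x ∈ X, ∀ a ∈ Θ, |u x a| ≤ M) :
    ∃ t' : ℝ → ℝ, ICIRMech Θ' X u x t' ∧ (∀ a, t a ≤ t' a) ∧ ∀ a ∈ Θ', |t' a| ≤ M := by
  have hrent := h.monotoneOn_rent hΘ' humono
  obtain ⟨hx, ht, ⟨K, hK⟩, hxX, hIC, hIR⟩ := h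
  set r := u (x a₀) a₀ - t a₀ with hr
  have hrle (a : ℝ) (ha : a ∈ Θ') : r ≤ u (x a) a - t a := hrent ha₀.1 ha (ha₀.2 ha)
  have hr0 : 0 ≤ r := hIR a₀ ha₀.1
  refine ⟨fun a => t a + r, ⟨hx, ht.add_const r, ⟨K + |r|, fun a => ?_⟩, hxX,
    fun a ha a' ha' => ?_, fun a ha => ?_⟩, fun a => by linarith, fun a ha => abs_le.mpr ⟨?_, ?_⟩⟩
  · exact (abs_add_le _ _).trans (by linarith [hK a])
  · linarith [hIC a ha a' ha']
  · linarith [hrle a ha]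
  · linarith [hIC a₀ ha₀.1 a ha, (abs_le.mp (hM _ (hxX a ha) _ (hΘ' ha₀.1))).1]
  · linarith [hrle a ha, (abs_le.mp (hM _ (hxX a ha) _ (hΘ' ha))).2]

/-- Mechanisms on ever finer discretizations of the type space have a subsequence converging
pointwise to an admissible mechanism on the whole type space. -/
lemma exists_subseq_tendsto_mechanism (hΘ : IsCompact Θ) (hX : IsCompact X)
    (huc : ContinuousOn (fun p : ℝ × ℝ => u p.1 p.2) (X ×ˢ Θ))
    (humono : ∀ x ∈ X, ∀ a ∈ Θ, ∀ a' ∈ Θ, a ≤ a' → u x a ≤ u x a')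
    (hSID : ∀ x ∈ X, ∀ x' ∈ X, x < x' → ∀ a ∈ Θ, ∀ a' ∈ Θ, a < a' →
      u x' a - u x a < u x' a' - u x a')
    {π x t : ℕ → ℝ → ℝ} (hπ : ∀ n, Measurable (π n)) (hπmono : ∀ n, MonotoneOn (π n) Θ)
    (hπΘ : ∀ n, MapsTo (π n) Θ Θ) (hπlim : ∀ a ∈ Θ, Tendsto (fun n => π n a) atTop (𝓝 a))
    (hmech : ∀ n, ICIRMech (π n '' Θ) X u (x n) (t n))
    {M : ℝ} (hu : ∀ x ∈ X, ∀ a ∈ Θ, |u x a| ≤ M) (ht : ∀ n, ∀ a ∈ π n '' Θ, |t n a| ≤ M) :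
    ∃ φ : ℕ → ℕ, StrictMono φ ∧ ∃ x' t' : ℝ → ℝ, ICIRMech Θ X u x' t' ∧
      ∀ a ∈ Θ, Tendsto (fun n => x (φ n) (π (φ n) a)) atTop (𝓝 (x' a)) ∧
        Tendsto (fun n => t (φ n) (π (φ n) a)) atTop (𝓝 (t' a)) := by
  have hsub (n : ℕ) : π n '' Θ ⊆ Θ := (hπΘ n).image_subset
  have hxX (n : ℕ) (a : ℝ) (ha : a ∈ Θ) : x n (π n a) ∈ X :=
    (hmech n).2.2.2.1 _ (mem_image_of_mem _ ha)
  have ht' (n : ℕ) (a : ℝ) (ha : a ∈ Θ) : |t n (π n a)| ≤ M := ht n _ (mem_image_of_mem _ ha)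
  obtain ⟨B, hB⟩ := hX.isBounded.exists_norm_le
  obtain ⟨φ₁, hφ₁, hlim₁⟩ := exists_subseq_tendsto_of_monotoneOn (S := Θ) (M := B)
    (f := fun n a => x n (π n a))
    (fun n a ha b hb hab => (hmech n).monotoneOn_allocation (hsub n) hSID
      (mem_image_of_mem _ ha) (mem_image_of_mem _ hb) (hπmono n ha hb hab))
    (fun n a ha => hB _ (hxX n a ha))
  obtain ⟨φ₂, hφ₂, hlim₂⟩ := exists_subseq_tendsto_of_monotoneOn (S := Θ) (M := M + M)
    (f := fun n a => u (x (φ₁ n) (π (φ₁ n) a)) (π (φ₁ n) a) - t (φ₁ n) (π (φ₁ n) a))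
    (fun n a ha b hb hab => (hmech (φ₁ n)).monotoneOn_rent (hsub _) humono
      (mem_image_of_mem _ ha) (mem_image_of_mem _ hb) (hπmono _ ha hb hab))
    (fun n a ha => (abs_sub _ _).trans
      (add_le_add (hu _ (hxX _ a ha) _ (hπΘ _ ha)) (ht' _ a ha)))
  set φ := φ₁ ∘ φ₂ with hφ
  have hφmono : StrictMono φ := hφ₁.comp hφ₂
  have hπφ (a : ℝ) (ha : a ∈ Θ) : Tendsto (fun n => π (φ n) a) atTop (𝓝 a) :=
    (hπlim a ha).comp hφmono.tendsto_atTop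
  have hx (a : ℝ) : ∃ l, a ∈ Θ → Tendsto (fun n => x (φ n) (π (φ n) a)) atTop (𝓝 l) := by
    by_cases ha : a ∈ Θ
    · exact (hlim₁ a ha).imp fun l hl _ => hl.comp hφ₂.tendsto_atTop
    · exact ⟨0, fun h => absurd h ha⟩
  choose xl hxl using hx
  have hxlX (a : ℝ) (ha : a ∈ Θ) : xl a ∈ X :=
    hX.isClosed.mem_of_tendsto (hxl a ha) (.of_forall fun n => hxX _ a ha)
  have hul (a b : ℝ) (ha : a ∈ Θ) (hb : b ∈ Θ) :
      Tendsto (fun n => u (x (φ n) (π (φ n) a)) (π (φ n) b)) atTop (𝓝 (u (xl a) b)) :=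
    tendsto_of_continuousOn_prod huc (hxl a ha) (hπφ b hb) (fun n => hxX _ a ha)
      (fun n => hπΘ _ hb) (hxlX a ha) hb
  have htl (a : ℝ) : ∃ l, a ∈ Θ → Tendsto (fun n => t (φ n) (π (φ n) a)) atTop (𝓝 l) := by
    by_cases ha : a ∈ Θ
    · obtain ⟨l, hl⟩ := hlim₂ a ha
      exact ⟨u (xl a) a - l, fun _ => ((hul a a ha ha).sub hl).congr fun n => by simp [hφ]⟩
    · exact ⟨0, fun h => absurd h ha⟩
  choose tl htl using htl
  have hmeas (y : ℕ → ℝ → ℝ) (yl : ℝ → ℝ) (hy : ∀ n, Measurable (y n))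
      (hyl : ∀ a ∈ Θ, Tendsto (fun n => y (φ n) (π (φ n) a)) atTop (𝓝 (yl a))) :
      Measurable (Θ.indicator yl) := by
    refine measurable_of_tendsto_metrizable
      (f := fun n => Θ.indicator fun a => y (φ n) (π (φ n) a))
      (fun n => ((hy _).comp (hπ _)).indicator hΘ.measurableSet) (tendsto_pi_nhds.mpr fun a => ?_)
    by_cases ha : a ∈ Θ
    · simpa [ha] using hyl a ha
    · simp [ha]
  have hM {a : ℝ} (ha : a ∈ Θ) : |tl a| ≤ M :=
    le_of_tendsto (htl a ha).abs (.of_forall fun n => ht' _ a ha)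
  refine ⟨φ, hφmono, Θ.indicator xl, Θ.indicator tl, ⟨hmeas x xl (fun n => (hmech n).1) hxl,
    hmeas t tl (fun n => (hmech n).2.1) htl, ⟨|M|, fun a => ?_⟩, fun a ha => ?_,
    fun a ha b hb => ?_, fun a ha => ?_⟩, fun a ha => ?_⟩
  · by_cases ha : a ∈ Θ
    · simpa [ha] using (hM ha).trans (le_abs_self M)
    · simp [ha]
  · simpa [ha] using hxlX a ha
  · simp only [indicator_of_mem ha, indicator_of_mem hb]
    exact le_of_tendsto_of_tendsto' ((hul b a hb ha).sub (htl b hb)) ((hul a a ha ha).sub (htl a ha))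
      fun n => (hmech (φ n)).2.2.2.2.1 _ (mem_image_of_mem _ ha) _ (mem_image_of_mem _ hb)
  · simp only [indicator_of_mem ha]
    exact ge_of_tendsto' ((hul a a ha ha).sub (htl a ha))
      fun n => (hmech (φ n)).2.2.2.2.2 _ (mem_image_of_mem _ ha)
  · simp only [indicator_of_mem ha]
    exact ⟨hxl a ha, htl a ha⟩

end Mechanism

section Value

variable {Θ Θ' X : Set ℝ} {u v : ℝ → ℝ → ℝ} {μ' : Measure ℝ} {C M : ℝ}

lemma ICIRMech.payoff_le [IsProbabilityMeasure μ'] (hΘ' : Θ' ⊆ Θ) (hμ' : μ' Θ'ᶜ = 0)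
    (hu : ∀ x ∈ X, ∀ a ∈ Θ, |u x a| ≤ M) (hv : ∀ x ∈ X, ∀ a ∈ Θ, |v x a| ≤ C)
    (hC : 0 ≤ C) (hM : 0 ≤ M) {x t : ℝ → ℝ} (h : ICIRMech Θ' X u x t) :
    ∫ a, (v (x a) a + t a) ∂μ' ≤ C + M := by
  by_cases hint : Integrable (fun a => v (x a) a + t a) μ'
  · have hle : ∀ᵐ a ∂μ', v (x a) a + t a ≤ C + M := by
      filter_upwards [show ∀ᵐ a ∂μ', a ∈ Θ' from hμ'] with a ha
      have hxa := h.2.2.2.1 a ha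
      linarith [(abs_le.mp (hv _ hxa a (hΘ' ha))).2, (abs_le.mp (hu _ hxa a (hΘ' ha))).2,
        h.2.2.2.2.2 a ha]
    simpa using integral_mono_ae hint (integrable_const _) hle
  · rw [integral_undef hint]
    positivity

lemma bddAbove_payoffs [IsProbabilityMeasure μ'] (hΘ' : Θ' ⊆ Θ) (hμ' : μ' Θ'ᶜ = 0)
    (hu : ∀ x ∈ X, ∀ a ∈ Θ, |u x a| ≤ M) (hv : ∀ x ∈ X, ∀ a ∈ Θ, |v x a| ≤ C)
    (hC : 0 ≤ C) (hM : 0 ≤ M) :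
    BddAbove {p : ℝ | ∃ x t : ℝ → ℝ, ICIRMech Θ' X u x t ∧
      p = ∫ a, (v (x a) a + t a) ∂μ'} := by
  refine ⟨C + M, ?_⟩
  rintro _ ⟨x, t, h, rfl⟩
  exact h.payoff_le hΘ' hμ' hu hv hC hM

lemma icirMech_const (hΘ' : Θ' ⊆ Θ) (hu : ∀ x ∈ X, ∀ a ∈ Θ, |u x a| ≤ M) {x₀ : ℝ}
    (hx₀ : x₀ ∈ X) : ICIRMech Θ' X u (fun _ => x₀) (fun _ => -M) :=
  ⟨measurable_const, measurable_const, ⟨|-M|, fun _ => le_rfl⟩, fun _ _ => hx₀,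
    fun _ _ _ _ => le_rfl, fun a ha => by
      linarith [(abs_le.mp (hu x₀ hx₀ a (hΘ' ha))).1]⟩

lemma neg_le_V [IsProbabilityMeasure μ'] (hΘ' : Θ' ⊆ Θ) (hμ' : μ' Θ'ᶜ = 0)
    (hu : ∀ x ∈ X, ∀ a ∈ Θ, |u x a| ≤ M) (hv : ∀ x ∈ X, ∀ a ∈ Θ, |v x a| ≤ C)
    (hC : 0 ≤ C) (hM : 0 ≤ M) (hX : X.Nonempty) : -(C + M) ≤ V X u v Θ' μ' := by
  obtain ⟨x₀, hx₀⟩ := hX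
  refine le_trans ?_ (le_csSup (bddAbove_payoffs hΘ' hμ' hu hv hC hM)
    ⟨fun _ => x₀, fun _ => -M, icirMech_const hΘ' hu hx₀, rfl⟩)
  have hbd : ∀ᵐ a ∂μ', ‖v x₀ a + -M‖ ≤ C + M := by
    filter_upwards [show ∀ᵐ a ∂μ', a ∈ Θ' from hμ'] with a ha
    refine (abs_add_le _ _).trans (add_le_add (hv _ hx₀ _ (hΘ' ha)) ?_)
    rw [abs_neg, abs_of_nonneg hM]
  have := norm_integral_le_of_norm_le_const hbd
  rw [probReal_univ, mul_one, Real.norm_eq_abs] at this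
  exact (abs_le.mp this).1

/-- Any value below `V` is exceeded by a mechanism with uniformly bounded transfers, since
transfers may be normalized when there is a lowest type. -/
lemma exists_normalized_lt_payoff [IsProbabilityMeasure μ'] (hfin : Θ'.Finite)
    (hΘ' : Θ' ⊆ Θ) (hne : Θ'.Nonempty) (hμ' : μ' Θ'ᶜ = 0) (hX : X.Nonempty)
    (humono : ∀ x ∈ X, ∀ a ∈ Θ, ∀ a' ∈ Θ, a ≤ a' → u x a ≤ u x a')
    (hu : ∀ x ∈ X, ∀ a ∈ Θ, |u x a| ≤ M) {c : ℝ} (hc : c < V X u v Θ' μ') :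
    ∃ x t : ℝ → ℝ, ICIRMech Θ' X u x t ∧ (∀ a ∈ Θ', |t a| ≤ M) ∧
      c < ∫ a, Θ'.indicator (fun a => v (x a) a + t a) a ∂μ' := by
  obtain ⟨x₀, hx₀⟩ := hX
  obtain ⟨_, ⟨x, t, h, rfl⟩, hlt⟩ := exists_lt_of_lt_csSup
    (⟨_, fun _ => x₀, fun _ => -M, icirMech_const hΘ' hu hx₀, rfl⟩ :
      {p : ℝ | ∃ x t : ℝ → ℝ, ICIRMech Θ' X u x t ∧
        p = ∫ a, (v (x a) a + t a) ∂μ'}.Nonempty) hc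
  obtain ⟨a₀, ha₀⟩ := hfin.exists_minimal hne
  have hleast : IsLeast Θ' a₀ := ⟨ha₀.1, fun b hb => (le_total a₀ b).elim id (ha₀.2 hb)⟩
  obtain ⟨t', h', htt', ht'⟩ := h.exists_normalized hΘ' hleast humono hu
  refine ⟨x, t', h', ht', hlt.trans_le ?_⟩
  have hind (s : ℝ → ℝ) : Integrable (Θ'.indicator fun a => v (x a) a + s a) μ' := by
    refine Integrable.of_bound (C := ∑ a ∈ hfin.toFinset, ‖v (x a) a + s a‖) ?_
      (.of_forall fun a => ?_)
    · refine (measurable_zero.measurable_of_countable_ne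
        (hfin.countable.mono fun a ha => ?_)).aestronglyMeasurable
      by_contra hna
      exact ha (by simp [hna])
    · by_cases ha : a ∈ Θ'
      · rw [indicator_of_mem ha]
        exact Finset.single_le_sum (f := fun a => ‖v (x a) a + s a‖)
          (fun _ _ => norm_nonneg _) (hfin.mem_toFinset.mpr ha)
      · rw [indicator_of_notMem ha, norm_zero]
        positivity
  have hae : (fun a => v (x a) a + t a) =ᵐ[μ'] Θ'.indicator fun a => v (x a) a + t a := by
    filter_upwards [show ∀ᵐ a ∂μ', a ∈ Θ' from hμ'] with a ha
    rw [indicator_of_mem ha]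
  rw [integral_congr_ae hae]
  exact integral_mono (hind t) (hind t')
    fun a => indicator_le_indicator (by linarith [htt' a])

end Value

section Discretization

/-- Rounding of a type down to the grid of mesh `1 / (n + 1)`, then up to the next element
of `Θ`. -/
def gridRound (Θ : Set ℝ) (n : ℕ) (a : ℝ) : ℝ :=
  sInf (Θ ∩ Ici ((⌊((n : ℝ) + 1) * a⌋ : ℝ) / ((n : ℝ) + 1)))

variable {Θ : Set ℝ}

lemma measurable_gridRound (n : ℕ) : Measurable (gridRound Θ n) :=
  (measurable_from_top (f := fun k : ℤ => sInf (Θ ∩ Ici ((k : ℝ) / ((n : ℝ) + 1))))).comp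
    (Int.measurable_floor.comp (measurable_const_mul _))

lemma floor_div_le (n : ℕ) (a : ℝ) :
    (⌊((n : ℝ) + 1) * a⌋ : ℝ) / ((n : ℝ) + 1) ≤ a := by
  rw [div_le_iff₀ (by positivity), mul_comm a]
  exact Int.floor_le _

lemma gridRound_isLeast (hΘ : IsCompact Θ) (n : ℕ) {a : ℝ} (ha : a ∈ Θ) :
    IsLeast (Θ ∩ Ici ((⌊((n : ℝ) + 1) * a⌋ : ℝ) / ((n : ℝ) + 1))) (gridRound Θ n a) :=
  (hΘ.inter_right isClosed_Ici).isLeast_sInf ⟨a, ha, floor_div_le n a⟩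

lemma mapsTo_gridRound (hΘ : IsCompact Θ) (n : ℕ) : MapsTo (gridRound Θ n) Θ Θ :=
  fun _ ha => (gridRound_isLeast hΘ n ha).1.1

lemma monotoneOn_gridRound (hΘ : IsCompact Θ) (n : ℕ) : MonotoneOn (gridRound Θ n) Θ := by
  intro a ha b hb hab
  have hb' := (gridRound_isLeast hΘ n hb).1
  refine (gridRound_isLeast hΘ n ha).2 ⟨hb'.1, ?_⟩
  refine le_trans ?_ (mem_Ici.mp hb'.2)
  gcongr

lemma tendsto_gridRound (hΘ : IsCompact Θ) {a : ℝ} (ha : a ∈ Θ) :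
    Tendsto (fun n => gridRound Θ n a) atTop (𝓝 a) := by
  have hlim : Tendsto (fun n : ℕ => a - 1 / ((n : ℝ) + 1)) atTop (𝓝 a) := by
    simpa using tendsto_const_nhds.sub (tendsto_one_div_add_atTop_nhds_zero_nat (𝕜 := ℝ))
  refine tendsto_of_tendsto_of_tendsto_of_le_of_le hlim tendsto_const_nhds (fun n => ?_)
    fun n => (gridRound_isLeast hΘ n ha).2 ⟨ha, floor_div_le n a⟩
  refine le_trans ?_ (gridRound_isLeast hΘ n ha).1.2
  have hn : (0 : ℝ) < (n : ℝ) + 1 := by positivity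
  rw [le_div_iff₀ hn, sub_mul, one_div_mul_cancel hn.ne', mul_comm a]
  exact (Int.sub_one_lt_floor _).le

lemma finite_image_gridRound (hΘ : IsCompact Θ) (n : ℕ) : (gridRound Θ n '' Θ).Finite := by
  obtain ⟨B, hB⟩ := hΘ.isBounded.exists_norm_le
  refine ((finite_Icc ⌊((n : ℝ) + 1) * -B⌋ ⌊((n : ℝ) + 1) * B⌋).image
    fun k : ℤ => sInf (Θ ∩ Ici ((k : ℝ) / ((n : ℝ) + 1)))).subset ?_
  rintro _ ⟨a, ha, rfl⟩
  have h := abs_le.mp (hB a ha)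
  have hn : (0 : ℝ) ≤ (n : ℝ) + 1 := by positivity
  exact ⟨_, ⟨Int.floor_le_floor (mul_le_mul_of_nonneg_left h.1 hn),
    Int.floor_le_floor (mul_le_mul_of_nonneg_left h.2 hn)⟩, rfl⟩

/-- The law of the rounded type, mixed with a vanishing weight on the uniform distribution so
that every grid type has positive probability. -/
def gridMeasure (Θ : Set ℝ) (μ : Measure ℝ) (n : ℕ) : Measure ℝ :=
  ENNReal.ofReal (1 - 1 / ((n : ℝ) + 1)) • μ.map (gridRound Θ n) +
    ENNReal.ofReal (1 / ((n : ℝ) + 1)) • ProbabilityTheory.uniformOn (gridRound Θ n '' Θ)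

variable {μ : Measure ℝ}

lemma one_div_succ_mem_Icc (n : ℕ) : 1 / ((n : ℝ) + 1) ∈ Icc (0 : ℝ) 1 :=
  ⟨by positivity, by rw [div_le_one (by positivity)]; linarith [n.cast_nonneg (α := ℝ)]⟩

lemma isProbabilityMeasure_uniformOn_gridRound (hΘ : IsCompact Θ) (hne : Θ.Nonempty) (n : ℕ) :
    IsProbabilityMeasure (ProbabilityTheory.uniformOn (gridRound Θ n '' Θ)) :=
  ProbabilityTheory.isProbabilityMeasure_uniformOn (finite_image_gridRound hΘ n) (hne.image _)

lemma isProbabilityMeasure_gridMeasure [IsProbabilityMeasure μ] (hΘ : IsCompact Θ)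
    (hne : Θ.Nonempty) (n : ℕ) : IsProbabilityMeasure (gridMeasure Θ μ n) := by
  have := isProbabilityMeasure_uniformOn_gridRound hΘ hne n
  have := Measure.isProbabilityMeasure_map (μ := μ) (measurable_gridRound (Θ := Θ) n).aemeasurable
  have hε := one_div_succ_mem_Icc n
  constructor
  simp only [gridMeasure, Measure.add_apply, Measure.smul_apply, measure_univ, smul_eq_mul, mul_one]
  rw [← ENNReal.ofReal_add (by linarith [hε.2]) hε.1]
  simp

lemma gridMeasure_compl (hΘ : IsCompact Θ) (hμ : μ Θᶜ = 0) (n : ℕ) :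
    gridMeasure Θ μ n (gridRound Θ n '' Θ)ᶜ = 0 := by
  have hfin := finite_image_gridRound hΘ n
  have h₁ : μ.map (gridRound Θ n) (gridRound Θ n '' Θ)ᶜ = 0 := by
    rw [Measure.map_apply (measurable_gridRound n) hfin.measurableSet.compl]
    exact measure_mono_null (fun a ha haΘ => ha (mem_image_of_mem _ haΘ)) hμ
  have h₂ : ProbabilityTheory.uniformOn (gridRound Θ n '' Θ) (gridRound Θ n '' Θ)ᶜ = 0 := by
    rw [ProbabilityTheory.uniformOn_eq_zero_iff hfin, inter_compl_self]
  simp [gridMeasure, h₁, h₂]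

lemma gridMeasure_singleton_pos (hΘ : IsCompact Θ) (n : ℕ) {a : ℝ}
    (ha : a ∈ gridRound Θ n '' Θ) : 0 < gridMeasure Θ μ n {a} := by
  have h : ProbabilityTheory.uniformOn (gridRound Θ n '' Θ) {a} ≠ 0 := by
    rw [Ne, ProbabilityTheory.uniformOn_eq_zero_iff (finite_image_gridRound hΘ n)]
    exact Set.Nonempty.ne_empty ⟨a, ha, rfl⟩
  have hε : 0 < ENNReal.ofReal (1 / ((n : ℝ) + 1)) := ENNReal.ofReal_pos.mpr (by positivity)
  simp only [gridMeasure, Measure.add_apply, Measure.smul_apply, smul_eq_mul]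
  exact (ENNReal.mul_pos hε.ne' h).trans_le le_add_self

lemma tendsto_integral_gridMeasure [IsProbabilityMeasure μ] (hΘ : IsCompact Θ)
    (hne : Θ.Nonempty) (hμ : μ Θᶜ = 0)
    {φ : ℕ → ℕ} (hφ : Tendsto φ atTop atTop) {H : ℕ → ℝ → ℝ} {g : ℝ → ℝ} {C : ℝ}
    (hH : ∀ n, Measurable (H n)) (hC : ∀ n a, |H n a| ≤ C)
    (hlim : ∀ a ∈ Θ, Tendsto (fun n => H n (gridRound Θ (φ n) a)) atTop (𝓝 (g a))) :
    Tendsto (fun n => ∫ a, H n a ∂(gridMeasure Θ μ (φ n))) atTop (𝓝 (∫ a, g a ∂μ)) := by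
  set ε : ℕ → ℝ := fun n => 1 / ((φ n : ℝ) + 1)
  have hε0 : Tendsto ε atTop (𝓝 0) :=
    (tendsto_one_div_add_atTop_nhds_zero_nat (𝕜 := ℝ)).comp hφ
  have hεI (n : ℕ) : ε n ∈ Icc (0 : ℝ) 1 := one_div_succ_mem_Icc _
  set ν : ℕ → Measure ℝ := fun n => ProbabilityTheory.uniformOn (gridRound Θ (φ n) '' Θ)
  have hνp (n : ℕ) : IsProbabilityMeasure (ν n) :=
    isProbabilityMeasure_uniformOn_gridRound hΘ hne _
  have hint (n : ℕ) (ρ : Measure ℝ) [IsProbabilityMeasure ρ] : Integrable (H n) ρ :=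
    Integrable.of_bound (hH n).aestronglyMeasurable C (.of_forall (hC n))
  have hsplit (n : ℕ) : ∫ a, H n a ∂(gridMeasure Θ μ (φ n)) =
      (1 - ε n) * ∫ a, H n (gridRound Θ (φ n) a) ∂μ + ε n * ∫ a, H n a ∂(ν n) := by
    have hπ := measurable_gridRound (Θ := Θ) (φ n)
    have := Measure.isProbabilityMeasure_map (μ := μ) hπ.aemeasurable
    rw [gridMeasure, integral_add_measure ((hint n _).smul_measure ENNReal.ofReal_ne_top)
        ((hint n (ν n)).smul_measure ENNReal.ofReal_ne_top), integral_smul_measure,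
      integral_smul_measure, integral_map hπ.aemeasurable (hH n).aestronglyMeasurable,
      ENNReal.toReal_ofReal (sub_nonneg.mpr (hεI n).2), ENNReal.toReal_ofReal (hεI n).1]
    rfl
  have hmain : Tendsto (fun n => ∫ a, H n (gridRound Θ (φ n) a) ∂μ) atTop (𝓝 (∫ a, g a ∂μ)) := by
    refine tendsto_integral_of_dominated_convergence (fun _ => C)
      (fun n => ((hH n).comp (measurable_gridRound _)).aestronglyMeasurable)
      (integrable_const C) (fun n => .of_forall fun a => hC n _) ?_
    filter_upwards [show ∀ᵐ a ∂μ, a ∈ Θ from hμ] using hlim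
  have hrest : Tendsto (fun n => ε n * ∫ a, H n a ∂(ν n)) atTop (𝓝 0) := by
    refine hε0.zero_mul_isBoundedUnder_le (isBoundedUnder_of ⟨C, fun n => ?_⟩)
    simpa using norm_integral_le_of_norm_le_const (μ := ν n) (f := H n) (.of_forall (hC n))
  simp only [hsplit]
  simpa using (((tendsto_const_nhds (x := (1 : ℝ))).sub hε0).mul hmain).add hrest

end Discretization

/-- **Approximation (Lemma 6).** If `v` is Lipschitz on `X × Θ`, there is a sequence
of finite subsets `Θⁿ ⊆ Θ` with full-support probability measures `μⁿ` such that
`μⁿ → μ` weakly and `limsup V(Θⁿ, μⁿ) ≤ V(Θ, μ)`. -/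
theorem stmt12
    (Θ X : Set ℝ) (hΘ : IsCompact Θ) (hX : IsCompact X) (hXne : X.Nonempty)
    (μ : Measure ℝ) (hμp : IsProbabilityMeasure μ) (hμsupp : μ Θᶜ = 0)
    (u v : ℝ → ℝ → ℝ)
    (huc : ContinuousOn (fun p : ℝ × ℝ => u p.1 p.2) (X ×ˢ Θ))
    (humono : ∀ x ∈ X, ∀ a ∈ Θ, ∀ a' ∈ Θ, a ≤ a' → u x a ≤ u x a')
    (hSID : ∀ x ∈ X, ∀ x' ∈ X, x < x' → ∀ a ∈ Θ, ∀ a' ∈ Θ, a < a' →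
      u x' a - u x a < u x' a' - u x a')
    (hvLip : ∃ K : NNReal, LipschitzOnWith K (fun p : ℝ × ℝ => v p.1 p.2) (X ×ˢ Θ)) :
    ∃ (Θseq : ℕ → Set ℝ) (μseq : ℕ → Measure ℝ),
      (∀ n, (Θseq n).Finite ∧ (Θseq n).Nonempty ∧ Θseq n ⊆ Θ) ∧
      (∀ n, IsProbabilityMeasure (μseq n) ∧ μseq n (Θseq n)ᶜ = 0 ∧
        ∀ a ∈ Θseq n, 0 < μseq n {a}) ∧
      (∀ f : BoundedContinuousFunction ℝ ℝ,
        Tendsto (fun n => ∫ a, f a ∂(μseq n)) atTop (nhds (∫ a, f a ∂μ))) ∧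
      limsup (fun n => V X u v (Θseq n) (μseq n)) atTop ≤ V X u v Θ μ := by
  have hΘne : Θ.Nonempty := by
    rw [nonempty_iff_ne_empty]
    rintro rfl
    simp at hμsupp
  obtain ⟨K, hK⟩ := hvLip
  have hvc := hK.continuousOn
  have hbound (w : ℝ → ℝ → ℝ) (hw : ContinuousOn (fun p : ℝ × ℝ => w p.1 p.2) (X ×ˢ Θ)) :
      ∃ B, 0 ≤ B ∧ ∀ x ∈ X, ∀ a ∈ Θ, |w x a| ≤ B := by
    obtain ⟨B, hB⟩ := (hX.prod hΘ).exists_bound_of_continuousOn hw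
    exact ⟨|B|, abs_nonneg B, fun x hx a ha => (hB (x, a) ⟨hx, ha⟩).trans (le_abs_self B)⟩
  obtain ⟨M, hM0, hM⟩ := hbound u huc
  obtain ⟨C, hC0, hC⟩ := hbound v hvc
  have hsub (n : ℕ) : gridRound Θ n '' Θ ⊆ Θ := (mapsTo_gridRound hΘ n).image_subset
  have hfin := finite_image_gridRound hΘ
  have hprob (n : ℕ) : IsProbabilityMeasure (gridMeasure Θ μ n) :=
    isProbabilityMeasure_gridMeasure hΘ hΘne n
  have hcompl := gridMeasure_compl (μ := μ) hΘ hμsupp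
  refine ⟨fun n => gridRound Θ n '' Θ, gridMeasure Θ μ,
    fun n => ⟨hfin n, hΘne.image _, hsub n⟩,
    fun n => ⟨hprob n, hcompl n, fun a ha => gridMeasure_singleton_pos hΘ n ha⟩,
    fun f => ?_, ?_⟩
  · exact tendsto_integral_gridMeasure hΘ hΘne hμsupp tendsto_id
      (fun _ => f.continuous.measurable) (fun _ => f.norm_coe_le_norm)
      fun a ha => (f.continuous.tendsto a).comp (tendsto_gridRound hΘ ha)
  refine le_of_forall_pos_le_add fun ε hε => limsup_le_of_le
    (isBoundedUnder_of ⟨-(C + M), fun n =>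
      neg_le_V (hsub n) (hcompl n) hM hC hC0 hM0 hXne⟩).isCoboundedUnder_le ?_
  by_contra hfreq
  obtain ⟨ψ, hψ, hψV⟩ := extraction_of_frequently_atTop (not_eventually.mp hfreq)
  choose x t hmech ht hpay using fun n => exists_normalized_lt_payoff (hfin (ψ n)) (hsub (ψ n))
    (hΘne.image _) (hcompl (ψ n)) hXne humono hM (not_le.mp (hψV n))
  obtain ⟨φ, hφ, x', t', hmech', hlim⟩ := exists_subseq_tendsto_mechanism hΘ hX huc humono hSID
    (fun n => measurable_gridRound (ψ n)) (fun n => monotoneOn_gridRound hΘ (ψ n))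
    (fun n => mapsTo_gridRound hΘ (ψ n))
    (fun a ha => (tendsto_gridRound hΘ ha).comp hψ.tendsto_atTop) hmech hM ht
  have hconv := tendsto_integral_gridMeasure (μ := μ) (φ := ψ ∘ φ) (C := C + M)
    (H := fun n => (gridRound Θ (ψ (φ n)) '' Θ).indicator fun a => v (x (φ n) a) a + t (φ n) a)
    (g := fun a => v (x' a) a + t' a) hΘ hΘne hμsupp (hψ.comp hφ).tendsto_atTop
    (fun n => measurable_zero.measurable_of_countable_ne
      ((hfin (ψ (φ n))).countable.mono fun a ha => by
        by_contra hna
        exact ha (by simp [indicator_of_notMem hna])))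
    (fun n a => by
      by_cases ha : a ∈ gridRound Θ (ψ (φ n)) '' Θ
      · rw [indicator_of_mem ha]
        exact (abs_add_le _ _).trans (add_le_add
          (hC _ ((hmech (φ n)).2.2.2.1 a ha) a (hsub _ ha)) (ht (φ n) a ha))
      · rw [indicator_of_notMem ha, abs_zero]
        positivity)
    (fun a ha => by
      simp only [Function.comp_apply, indicator_of_mem (mem_image_of_mem _ ha)]
      exact (tendsto_of_continuousOn_prod hvc (hlim a ha).1
        ((tendsto_gridRound hΘ ha).comp (hψ.comp hφ).tendsto_atTop)
        (fun n => (hmech (φ n)).2.2.2.1 _ (mem_image_of_mem _ ha))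
        (fun n => mapsTo_gridRound hΘ _ ha) (hmech'.2.2.2.1 a ha) ha).add (hlim a ha).2)
  have hle := ge_of_tendsto' hconv fun n => (hpay (φ n)).le
  have hV : ∫ a, (v (x' a) a + t' a) ∂μ ≤ V X u v Θ μ :=
    le_csSup (bddAbove_payoffs subset_rfl hμsupp hM hC hC0 hM0) ⟨x', t', hmech', rfl⟩
  linarith
end
end

section
/- (Monotone coupling.) Let γ be a Borel probability measure on Θ^A × Θ^B with Θ^A ⊆ ℝ and Θ^B ⊆ ℝ^N compact, and suppose θ^B is stochastically nondecreasing in θ^A under γ. Then there exist a measurable space E, a probability measure on Θ^A × E that is the product of the marginal of θ^A under γ and some probability measure on E (so the two coordinates are independent and the first has the correct marginal), and a measurable function h : Θ^A × E → ℝ^N nondecreasing in its first argument, such that the pushforward of this product measure under the map (a, ε) ↦ (a, h(a, ε)) equals γ. -/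
open MeasureTheory Set ProbabilityTheory

noncomputable section

/-- `κ` is a regular conditional distribution of the second coordinate given the
first coordinate, under the joint law `γ`. -/
def IsRCD {A B : Type*} [MeasurableSpace A] [MeasurableSpace B]
    (γ : Measure (A × B)) (κ : Kernel A B) : Prop :=
  IsMarkovKernel κ ∧
    ∀ s : Set (A × B), MeasurableSet s →
      γ s = ∫⁻ a, κ a {b | (a, b) ∈ s} ∂γ.fst

/-- The topological support of a measure on `ℝ`. -/
def MSupport (μ : Measure ℝ) : Set ℝ :=
  {a | ∀ U : Set ℝ, IsOpen U → a ∈ U → 0 < μ U}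

/-- Integral form of the existence of a monotone coupling along a finite chain. -/
theorem chain_integral_nonneg {D K : Type*} [LinearOrder D]
    [TopologicalSpace K] [CompactSpace K] [SemilatticeSup K] [ContinuousSup K]
    [MeasurableSpace K] [BorelSpace K] (κ : D → Measure K) [∀ d, IsProbabilityMeasure (κ d)]
    (hκ : ∀ d d', d ≤ d' → ∀ f : C(K, ℝ), Monotone f → ∫ x, f x ∂κ d ≤ ∫ x, f x ∂κ d')
    (s : Finset D) : ∀ φ : D → C(K, ℝ),
      (∀ x : D → K, Monotone x → 0 ≤ ∑ d ∈ s, φ d (x d)) →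
      0 ≤ ∑ d ∈ s, ∫ x, φ d x ∂κ d := by
  classical
  have h_integrable : ∀ (d : D) (f : C(K, ℝ)), Integrable f (κ d) := fun d f =>
    f.continuous.integrable_of_hasCompactSupport (HasCompactSupport.of_compactSpace _)
  induction s using Finset.induction_on_max with
  | empty => simp
  | insert m s hm ih =>
    intro φ hφ
    have hms : m ∉ s := fun h => (hm m h).false
    rcases s.eq_empty_or_nonempty with rfl | hs
    · simp only [insert_empty_eq, Finset.sum_singleton] at hφ ⊢
      exact integral_nonneg fun k => hφ (fun _ => k) monotone_const
    obtain ⟨m', hm's, hm'max⟩ : ∃ m' ∈ s, ∀ d ∈ s, d ≤ m' :=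
      ⟨s.max' hs, s.max'_mem hs, fun d hd => s.le_max' d hd⟩
    let u : C(K, ℝ) := ⟨fun x => sInf ((fun y => φ m (x ⊔ y)) '' univ),
      isCompact_univ.continuous_sInf (f := fun x y => φ m (x ⊔ y))
        ((φ m).continuous.comp continuous_sup)⟩
    have hbdd : ∀ x, BddBelow ((fun y => φ m (x ⊔ y)) '' univ) := fun x =>
      (isCompact_univ.image ((φ m).continuous.comp
        (continuous_const.sup continuous_id))).bddBelow
    have hu_le : ∀ x y, x ≤ y → u x ≤ φ m y := fun x y hxy =>
      csInf_le (hbdd x) ⟨y, mem_univ _, by simp [sup_eq_right.2 hxy]⟩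
    have hle_u : ∀ x c, (∀ y, x ≤ y → c ≤ φ m y) → c ≤ u x := fun x c h =>
      le_csInf ⟨_, x, mem_univ _, rfl⟩ (by rintro _ ⟨y, -, rfl⟩; exact h _ le_sup_left)
    have hu_mono : Monotone u := fun x x' h => hle_u _ _ fun y hy => hu_le _ _ (h.trans hy)
    have key := ih (φ + Pi.single m' u) (fun x hx => by
      simp only [Pi.add_apply, ContinuousMap.add_apply, Finset.sum_add_distrib]
      rw [Finset.sum_eq_single_of_mem (f := fun d => (Pi.single m' u : D → C(K, ℝ)) d (x d)) m' hm's
        (fun d _ hd => by simp [Pi.single_eq_of_ne hd]), Pi.single_eq_same, ← neg_le_iff_add_nonneg']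
      refine hle_u _ _ fun y hy => ?_
      have := hφ (fun d => if d ≤ m' then x d else y) (fun d d' hdd => by
        dsimp only
        split_ifs with h1 h2 h2
        · exact hx hdd
        · exact (hx h1).trans hy
        · exact absurd (hdd.trans h2) h1
        · exact le_rfl)
      rw [Finset.sum_insert hms, if_neg (hm _ hm's).not_ge,
        Finset.sum_congr rfl (fun d hd => by rw [if_pos (hm'max d hd)])] at this
      linarith)
    simp only [Pi.add_apply, ContinuousMap.add_apply] at key
    rw [Finset.sum_congr rfl (fun d _ => integral_add (h_integrable d _) (h_integrable d _)),
      Finset.sum_add_distrib,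
      Finset.sum_eq_single_of_mem
        (f := fun d => ∫ a, (Pi.single m' u : D → C(K, ℝ)) d a ∂κ d) m' hm's
        (fun d _ hd => by simp [Pi.single_eq_of_ne hd]),
      Pi.single_eq_same] at key
    rw [Finset.sum_insert hms]
    have h1 := hκ m' m (hm _ hm's).le u hu_mono
    have h2 := integral_mono (h_integrable m u) (h_integrable m (φ m)) fun x => hu_le x x le_rfl
    linarith

/-- Every positive linear functional on `C(X, ℝ)` is integration against a finite measure. -/
theorem exists_measure_integral_eq {X : Type*} [TopologicalSpace X] [T2Space X] [CompactSpace X]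
    [MeasurableSpace X] [BorelSpace X] (Λ : C(X, ℝ) →ₗ[ℝ] ℝ)
    (hΛ : ∀ f : C(X, ℝ), (∀ x, 0 ≤ f x) → 0 ≤ Λ f) :
    ∃ μ : Measure X, IsFiniteMeasure μ ∧ ∀ f : C(X, ℝ), ∫ x, f x ∂μ = Λ f := by
  let T : CompactlySupportedContinuousMap X ℝ →ₗ[ℝ] ℝ :=
    { toFun := fun f => Λ f.toContinuousMap
      map_add' := fun f g => by rw [← map_add]; rfl
      map_smul' := fun c f => by rw [RingHom.id_apply, ← map_smul]; rfl }
  let T' := PositiveLinearMap.mk₀ T fun f hf => hΛ _ (CompactlySupportedContinuousMap.le_def.1 hf)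
  refine ⟨RealRMK.rieszMeasure T', ?_, fun f => ?_⟩
  · infer_instance
  · exact RealRMK.integral_rieszMeasure T' (CompactlySupportedContinuousMap.continuousMapEquiv f)

/-- A stochastically nondecreasing family of probability measures on a compact ordered space,
indexed by a countable chain, is the family of marginals of a law on nondecreasing paths. -/
theorem exists_monotone_coupling {D K : Type*} [LinearOrder D] [Countable D] [Nonempty D]
    [PseudoMetricSpace K] [T2Space K] [CompactSpace K] [Lattice K] [ContinuousSup K]
    [OrderClosedTopology K] [MeasurableSpace K] [BorelSpace K]
    (κ : D → Measure K) [∀ d, IsProbabilityMeasure (κ d)]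
    (hκ : ∀ d d', d ≤ d' → ∀ f : C(K, ℝ), Monotone f → ∫ x, f x ∂κ d ≤ ∫ x, f x ∂κ d') :
    ∃ P : Measure {x : D → K // Monotone x}, IsProbabilityMeasure P ∧
      ∀ d, P.map (fun x => x.1 d) = κ d := by
  classical
  have hclosed : IsClosed {x : D → K | Monotone x} := by
    simp only [Monotone, ofPred_forall]
    exact isClosed_iInter fun d => isClosed_iInter fun d' => isClosed_iInter fun _ =>
      isClosed_le (continuous_apply d) (continuous_apply d')
  have : CompactSpace {x : D → K // Monotone x} := isCompact_iff_compactSpace.1 hclosed.isCompact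
  let X := {x : D → K // Monotone x}
  have : BorelSpace X := inferInstance
  have h_integrable : ∀ (d : D) (f : C(K, ℝ)), Integrable f (κ d) := fun d f =>
    f.continuous.integrable_of_hasCompactSupport (HasCompactSupport.of_compactSpace _)
  have hev : ∀ d : D, Continuous fun x : X => x.1 d := fun d =>
    (continuous_apply d).comp continuous_subtype_val
  let ev : D → C(X, K) := fun d => ⟨fun x => x.1 d, hev d⟩
  let Φ : (D →₀ C(K, ℝ)) →ₗ[ℝ] C(X, ℝ) :=
    Finsupp.lsum ℝ fun d => (ContinuousMap.compRightAlgHom ℝ ℝ (ev d)).toLinearMap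
  let T : (D →₀ C(K, ℝ)) →ₗ[ℝ] ℝ := Finsupp.lsum ℝ fun d =>
    { toFun := fun f => ∫ x, f x ∂κ d
      map_add' := fun f g => integral_add (h_integrable d f) (h_integrable d g)
      map_smul' := fun c f => integral_const_mul c f }
  have hΦ : ∀ φ x, Φ φ x = ∑ d ∈ φ.support, φ d (x.1 d) := fun φ x => by
    simp [Φ, Finsupp.lsum_apply, Finsupp.sum, ContinuousMap.sum_apply, ev]
  have hΦs : ∀ d f x, Φ (Finsupp.single d f) x = f (x.1 d) := fun d f x => by
    simp [Φ, ev]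
  have hTs : ∀ d f, T (Finsupp.single d f) = ∫ x, f x ∂κ d := fun d f => by
    simp [T]
  have hT : ∀ φ, (∀ x, 0 ≤ Φ φ x) → 0 ≤ T φ := fun φ h =>
    chain_integral_nonneg κ hκ φ.support φ fun x hx => by simpa [hΦ] using h ⟨x, hx⟩
  let S : PointedCone ℝ ((D →₀ C(K, ℝ)) × C(X, ℝ)) :=
    { carrier := {p | ∀ x, 0 ≤ Φ p.1 x + p.2 x}
      add_mem' := fun {p q} hp hq x => by
        have h1 := hp x
        have h2 := hq x
        simp only [Prod.fst_add, Prod.snd_add, map_add, ContinuousMap.add_apply]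
        linarith
      zero_mem' := fun x => by simp
      smul_mem' := fun c p hp x => by
        have h := mul_nonneg c.2 (hp x)
        have h1 : Φ (c • p).1 x + (c • p).2 x = c.1 * (Φ p.1 x + p.2 x) := by
          change Φ (c.1 • p.1) x + (c.1 • p.2) x = _
          simp only [map_smul, ContinuousMap.smul_apply, smul_eq_mul, mul_add]
        rw [h1]
        exact h }
  obtain ⟨G, hGT, hG⟩ := riesz_extension S
    ⟨LinearMap.ker (LinearMap.snd ℝ _ _), T ∘ₗ LinearMap.fst ℝ _ _ ∘ₗ Submodule.subtype _⟩
    (fun p hp => hT _ fun x => by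
      have h2 : (p : (D →₀ C(K, ℝ)) × C(X, ℝ)).2 = 0 := p.2
      simpa [h2] using hp x)
    (fun p => by
      obtain ⟨d⟩ := ‹Nonempty D›
      refine ⟨⟨(Finsupp.single d (ContinuousMap.const K ‖p.2‖) - p.1, 0), rfl⟩, fun x => ?_⟩
      have h := neg_le_of_abs_le (p.2.norm_coe_le_norm x)
      have h' : Φ (Finsupp.single d (ContinuousMap.const K ‖p.2‖)) x = ‖p.2‖ := hΦs _ _ _
      simp only [Prod.fst_add, Prod.snd_add, sub_add_cancel, zero_add, h']
      linarith)
  obtain ⟨P, hP, hPi⟩ := exists_measure_integral_eq (G ∘ₗ LinearMap.inr ℝ _ _) fun f hf =>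
    hG _ fun x => by simpa using hf x
  have hGΦ : ∀ φ, G (0, Φ φ) = T φ := fun φ => by
    have h1 : G (φ, 0) = T φ := hGT ⟨(φ, 0), rfl⟩
    have h2 := hG (φ, -Φ φ) fun x => by simp
    have h3 := hG (-φ, Φ φ) fun x => by simp
    have e2 : ((φ, -Φ φ) : (D →₀ C(K, ℝ)) × C(X, ℝ)) = (φ, 0) - (0, Φ φ) := by simp
    have e3 : ((-φ, Φ φ) : (D →₀ C(K, ℝ)) × C(X, ℝ)) = (0, Φ φ) - (φ, 0) := by simp
    rw [e2, map_sub] at h2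
    rw [e3, map_sub] at h3
    linarith
  have hmarg : ∀ d, P.map (fun x => x.1 d) = κ d := fun d => by
    have := Measure.isFiniteMeasure_map P (fun x : X => x.1 d)
    refine ext_of_forall_integral_eq_of_IsFiniteMeasure fun f => ?_
    rw [integral_map (hev d).measurable.aemeasurable f.continuous.aestronglyMeasurable]
    have h1 := hPi (Φ (Finsupp.single d f.toContinuousMap))
    simp only [hΦs, LinearMap.comp_apply, LinearMap.inr_apply, hGΦ, hTs] at h1
    exact h1
  refine ⟨P, ⟨?_⟩, hmarg⟩
  obtain ⟨d⟩ := ‹Nonempty D›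
  have := congrArg (fun m => m univ) (hmarg d)
  simpa [Measure.map_apply (hev d).measurable] using this

/-- Finite measures on `ι → ℝ` are determined by their values on upper orthants with rational
vertices. -/
theorem measure_ext_of_Ici_rat {ι : Type*} [Fintype ι] {μ ν : Measure (ι → ℝ)}
    [IsProbabilityMeasure μ] [IsProbabilityMeasure ν]
    (h : ∀ q : ι → ℚ, μ (Ici fun i => (q i : ℝ)) = ν (Ici fun i => (q i : ℝ))) : μ = ν := by
  have hgen := generateFrom_pi_eq (ι := ι) (α := fun _ => ℝ)
    (C := fun _ => ⋃ a : ℚ, {Ici (a : ℝ)}) fun _ =>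
      ⟨fun n => Ici (((-n : ℤ) : ℚ) : ℝ), fun n => mem_iUnion.2 ⟨_, rfl⟩, by
        refine eq_univ_of_forall fun x => mem_iUnion.2 ?_
        obtain ⟨n, hn⟩ := exists_nat_ge (-x)
        exact ⟨n, by simp only [mem_Ici]; push_cast; linarith⟩⟩
  rw [← Real.borel_eq_generateFrom_Ici_rat] at hgen
  refine ext_of_generate_finite _ ?_ (IsPiSystem.pi fun _ : ι => Real.isPiSystem_Ici_rat) ?_ ?_
  · rw [← hgen, (inferInstance : BorelSpace ℝ).measurable_eq.symm]
  · rintro _ ⟨s, hs, rfl⟩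
    have hs' : ∀ i, ∃ q : ℚ, s i = Ici (q : ℝ) := fun i => by
      simpa [eq_comm] using hs i (mem_univ i)
    choose q hq using hs'
    have : univ.pi s = Ici fun i => (q i : ℝ) := by
      rw [← pi_univ_Ici]
      exact congrArg _ (funext hq)
    rw [this, h]
  · simp

/-- A stochastically nondecreasing family of probability measures on the cube `[-R, R]^ι`, indexed
by `ℝ`, is realised by a random nondecreasing function. -/
theorem exists_monotone_realization {ι : Type} [Fintype ι] {R : ℝ} (hR : -R ≤ R)
    (κ : ℝ → Measure (ι → Icc (-R) R)) [∀ a, IsProbabilityMeasure (κ a)]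
    (hκ : ∀ a a', a ≤ a' → ∀ f : (ι → Icc (-R) R) → ℝ, Measurable f → Monotone f →
      (∃ M, ∀ b, |f b| ≤ M) → ∫ b, f b ∂κ a ≤ ∫ b, f b ∂κ a') :
    ∃ (E : Type) (_ : MeasurableSpace E) (P : Measure E), IsProbabilityMeasure P ∧
      ∃ h : ℝ × E → (ι → ℝ), Measurable h ∧
        (∀ e a a', a ≤ a' → h (a, e) ≤ h (a', e)) ∧
        ∀ a, P.map (fun e => h (a, e)) = (κ a).map fun b i => (b i : ℝ) := by
  classical
  let A : (ι → ℚ) → Set (ι → Icc (-R) R) := fun q => {b | ∀ i, (q i : ℝ) ≤ b i}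
  have hcoe : Measurable fun (b : ι → Icc (-R) R) i => (b i : ℝ) :=
    measurable_pi_lambda _ fun i => measurable_subtype_coe.comp (measurable_pi_apply i)
  have hA : ∀ q, MeasurableSet (A q) := fun q => by
    simp only [A, ofPred_forall]
    exact MeasurableSet.iInter fun i =>
      measurableSet_le measurable_const (measurable_subtype_coe.comp (measurable_pi_apply i))
  have hF : ∀ q, Monotone fun a => κ a (A q) := fun q a a' haa => by
    have h := hκ a a' haa ((A q).indicator 1) (measurable_one.indicator (hA q))
      (fun b b' hbb => by
        by_cases hb : b ∈ A q
        · have hb' : b' ∈ A q := fun i => (hb i).trans (hbb i)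
          simp [hb, hb']
        · rw [indicator_of_notMem hb]
          exact indicator_nonneg (fun _ _ => zero_le_one) _)
      ⟨1, fun b => by by_cases hb : b ∈ A q <;> simp [hb]⟩
    rw [integral_indicator_one (hA q), integral_indicator_one (hA q)] at h
    exact (ENNReal.toReal_le_toReal (measure_ne_top _ _) (measure_ne_top _ _)).1 h
  let D : Set ℝ := range ((↑) : ℚ → ℝ) ∪ ⋃ q, {a | ¬ContinuousAt (fun a => κ a (A q)) a}
  have hD : D.Countable := (countable_range _).union
    (countable_iUnion fun q => (hF q).countable_not_continuousAt)
  have : Countable D := hD.to_subtype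
  have hDrat : ∀ r : ℚ, (r : ℝ) ∈ D := fun r => Or.inl ⟨r, rfl⟩
  have : Nonempty D := ⟨⟨_, hDrat 0⟩⟩
  have : ContinuousSup (ι → Icc (-R) R) := ⟨continuous_pi fun i =>
    ((continuous_apply i).comp continuous_fst).sup ((continuous_apply i).comp continuous_snd)⟩
  obtain ⟨P, hP, hmarg⟩ := exists_monotone_coupling (fun d : D => κ d) fun d d' hd f hf =>
    hκ d d' hd f f.continuous.measurable hf
      ⟨‖f‖, fun b => f.norm_coe_le_norm b⟩
  let E := {x : D → (ι → Icc (-R) R) // Monotone x}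
  have hev : ∀ d : D, Measurable fun e : E => e.1 d := fun d =>
    (measurable_pi_apply d).comp measurable_subtype_coe
  let t : ℝ × E → ι → D → ℝ := fun p i d => if p.1 ≤ d then (p.2.1 d i : ℝ) else R
  have htb : ∀ p i, BddBelow (range (t p i)) := fun p i => ⟨-R, by
    rintro _ ⟨d, rfl⟩
    dsimp only [t]
    split_ifs
    · exact (p.2.1 d i).2.1
    · exact hR⟩
  let h : ℝ × E → ι → ℝ := fun p i => ⨅ d, t p i d
  have hh : Measurable h := measurable_pi_lambda _ fun i => Measurable.iInf fun d =>
    Measurable.ite (measurableSet_le measurable_fst measurable_const)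
      (measurable_subtype_coe.comp ((measurable_pi_apply i).comp ((hev d).comp measurable_snd)))
      measurable_const
  refine ⟨E, inferInstance, P, hP, h, hh, fun e a a' haa i => ?_, fun a => ?_⟩
  · refine ciInf_mono (htb _ _) fun d => ?_
    dsimp only [t]
    split_ifs with h1 h2 h2
    · exact le_rfl
    · exact (e.1 d i).2.2
    · exact absurd (haa.trans h2) h1
    · exact le_rfl
  have hha : Measurable fun e => h (a, e) := hh.comp measurable_prodMk_left
  have := Measure.isProbabilityMeasure_map (μ := P) hha.aemeasurable
  have := Measure.isProbabilityMeasure_map (μ := κ a) hcoe.aemeasurable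
  refine measure_ext_of_Ici_rat fun q => ?_
  rw [Measure.map_apply hha measurableSet_Ici, Measure.map_apply hcoe measurableSet_Ici]
  have hpre : (fun (b : ι → Icc (-R) R) i => (b i : ℝ)) ⁻¹' Ici (fun i => (q i : ℝ)) = A q := rfl
  obtain ⟨r, hr⟩ := exists_rat_gt a
  have : Nonempty {d : D // a ≤ d} := ⟨⟨⟨r, hDrat r⟩, hr.le⟩⟩
  have hset : (fun e => h (a, e)) ⁻¹' Ici (fun i => (q i : ℝ)) =
      ⋂ d : {d : D // a ≤ d}, {e : E | e.1 d.1 ∈ A q} := by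
    ext e
    simp only [mem_preimage, mem_Ici, Pi.le_def, mem_iInter, mem_ofPred_eq]
    constructor
    · intro H d i
      have := (H i).trans (ciInf_le (htb _ _) d.1)
      simpa only [t, if_pos d.2] using this
    · intro H i
      refine le_ciInf fun d => ?_
      dsimp only [t]
      split_ifs with had
      · exact H ⟨d, had⟩ i
      · exact (H ⟨⟨r, hDrat r⟩, hr.le⟩ i).trans (e.1 _ i).2.2
  have hPA : ∀ d : D, P {e : E | e.1 d ∈ A q} = κ d (A q) := fun d => by
    rw [← hmarg d, Measure.map_apply (hev d) (hA q)]
    rfl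
  have hmono : Monotone fun d : {d : D // a ≤ d} => {e : E | e.1 d.1 ∈ A q} :=
    fun d d' hd e he i => (he i).trans (e.2 (show d.1 ≤ d'.1 from hd) i)
  rw [hpre, hset, hmono.measure_iInter (fun d => ((hev d.1) (hA q)).nullMeasurableSet)
    ⟨Classical.arbitrary _, measure_ne_top _ _⟩]
  simp only [hPA]
  refine le_antisymm ?_ (le_iInf fun d => hF q d.2)
  by_cases haD : a ∈ D
  · exact iInf_le (fun d : {d : D // a ≤ d} => κ d.1 (A q)) ⟨⟨a, haD⟩, le_rfl⟩
  · have hc : ContinuousAt (fun a => κ a (A q)) a := by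
      by_contra hc
      exact haD (Or.inr (mem_iUnion.2 ⟨q, hc⟩))
    refine le_of_forall_gt fun c hlt => ?_
    obtain ⟨u, hu, hsub⟩ := exists_Ico_subset_of_mem_nhds (hc.eventually_lt_const hlt)
      (exists_gt a)
    obtain ⟨r, hr1, hr2⟩ := exists_rat_btwn hu
    exact (iInf_le (fun d : {d : D // a ≤ d} => κ d.1 (A q)) ⟨⟨r, hDrat r⟩, hr1.le⟩).trans_lt
      (hsub ⟨hr1.le, hr2⟩)

/-- A compact set of reals admits a nondecreasing retraction of the line onto it. -/
theorem IsCompact.exists_monotone_retraction {S : Set ℝ} (hS : IsCompact S) (hne : S.Nonempty) :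
    ∃ π : ℝ → ℝ, Monotone π ∧ (∀ a, π a ∈ S) ∧ ∀ a ∈ S, π a = a := by
  have hmin := hS.sInf_mem hne
  have hTne : ∀ a, (S ∩ Iic (max a (sInf S))).Nonempty := fun a => ⟨sInf S, hmin, mem_Iic.2 (le_max_right _ _)⟩
  have hTb : ∀ a, BddAbove (S ∩ Iic (max a (sInf S))) := fun a => hS.bddAbove.mono inter_subset_left
  refine ⟨fun a => sSup (S ∩ Iic (max a (sInf S))), fun a a' haa => ?_, fun a => ?_, fun a ha => ?_⟩
  · exact csSup_le_csSup (hTb a') (hTne a)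
      (inter_subset_inter_right _ (Iic_subset_Iic.2 (max_le_max_right _ haa)))
  · exact ((hS.isClosed.inter isClosed_Iic).csSup_mem (hTne a) (hTb a)).1
  · refine le_antisymm (csSup_le (hTne a) fun b hb => ?_) (le_csSup (hTb a) ⟨ha, mem_Iic.2 (le_max_left _ _)⟩)
    exact hb.2.trans (max_le le_rfl (csInf_le hS.bddBelow ha))

theorem MSupport_eq_support (μ : Measure ℝ) : MSupport μ = μ.support := by
  ext a
  rw [Measure.mem_support_iff_forall]
  refine ⟨fun h U hU => ?_, fun h U hU ha => h U (hU.mem_nhds ha)⟩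
  obtain ⟨V, hVU, hV, haV⟩ := mem_nhds_iff.1 hU
  exact (h V hV haV).trans_le (measure_mono hVU)

/-- **Monotone coupling (Lemma 1, after Strassen / Kamae–Krengel–O'Brien).**
If `θ^B` is stochastically nondecreasing in `θ^A`, then `γ` is the law of
`(θ^A, h(θ^A; ε))` for some independent randomness `ε` and some map `h` that is
nondecreasing in `θ^A`. -/
theorem stmt14
    (N : ℕ)
    (ΘA : Set ℝ) (ΘB : Set (Fin N → ℝ))
    (hΘA : IsCompact ΘA) (hΘB : IsCompact ΘB)
    (γ : Measure (ℝ × (Fin N → ℝ))) (hγp : IsProbabilityMeasure γ)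
    (hγsupp : γ ((ΘA ×ˢ ΘB)ᶜ) = 0)
    -- θ^B is stochastically nondecreasing in θ^A
    (hmono : ∃ κ : Kernel ℝ (Fin N → ℝ), IsRCD γ κ ∧
      ∀ a ∈ MSupport γ.fst, ∀ a' ∈ MSupport γ.fst, a < a' →
        ∀ f : (Fin N → ℝ) → ℝ, Measurable f → Monotone f →
          (∃ M, ∀ b, |f b| ≤ M) →
          ∫ b, f b ∂(κ a) ≤ ∫ b, f b ∂(κ a')) :
    ∃ (E : Type) (mE : MeasurableSpace E) (ν : Measure E),
      IsProbabilityMeasure ν ∧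
      ∃ hfun : ℝ × E → (Fin N → ℝ),
        Measurable hfun ∧
        (∀ e : E, ∀ a ∈ ΘA, ∀ a' ∈ ΘA, a ≤ a' → hfun (a, e) ≤ hfun (a', e)) ∧
        Measure.map (fun p : ℝ × E => (p.1, hfun p)) ((γ.fst).prod ν) = γ := by
  obtain ⟨κ, ⟨hκp, hκγ⟩, hκm⟩ := hmono
  have hΘA0 : γ.fst ΘAᶜ = 0 := by
    rw [Measure.fst_apply hΘA.measurableSet.compl]
    exact measure_mono_null (fun p hp hp' => hp (mem_prod.1 hp').1) hγsupp
  have hΘB0 : ∀ᵐ a ∂γ.fst, κ a ΘBᶜ = 0 := by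
    have h : γ (Prod.snd ⁻¹' ΘBᶜ) = 0 :=
      measure_mono_null (fun p hp hp' => hp (mem_prod.1 hp').2) hγsupp
    rw [hκγ _ (measurable_snd hΘB.measurableSet.compl)] at h
    change ∫⁻ a, κ a ΘBᶜ ∂γ.fst = 0 at h
    rw [lintegral_eq_zero_iff (κ.measurable_coe hΘB.measurableSet.compl)] at h
    exact h
  rw [MSupport_eq_support] at hκm
  have hSΘ : γ.fst.support ⊆ ΘA :=
    Measure.support_subset_of_isClosed hΘA.isClosed (mem_ae_iff.2 hΘA0)
  have hS : IsCompact γ.fst.support := hΘA.of_isClosed_subset Measure.isClosed_support hSΘ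
  obtain ⟨π, hπm, hπS, hπ⟩ := hS.exists_monotone_retraction
    (Measure.nonempty_support (IsProbabilityMeasure.ne_zero _))
  obtain ⟨R, hR0, hR⟩ := hΘB.isBounded.exists_pos_norm_le
  have hRR : -R ≤ R := by linarith
  let c : (Fin N → ℝ) → (Fin N → Icc (-R) R) := fun b i => projIcc (-R) R hRR (b i)
  have hc : Measurable c := measurable_pi_lambda _ fun i =>
    continuous_projIcc.measurable.comp (measurable_pi_apply i)
  have hcm : Monotone c := fun b b' hbb i => monotone_projIcc hRR (hbb i)
  have hcoe : Measurable fun (b : Fin N → Icc (-R) R) i => (b i : ℝ) :=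
    measurable_pi_lambda _ fun i => measurable_subtype_coe.comp (measurable_pi_apply i)
  have hcΘ : ∀ b ∈ ΘB, (fun i => (c b i : ℝ)) = b := fun b hb => funext fun i => by
    have h := abs_le.1 ((norm_le_pi_norm b i).trans (hR b hb))
    simp only [c, projIcc_of_mem hRR h]
  have hκ' : ∀ a, IsProbabilityMeasure ((κ (π a)).map c) := fun a =>
    Measure.isProbabilityMeasure_map hc.aemeasurable
  obtain ⟨E, mE, P, hP, h, hh, hhm, hhκ⟩ := exists_monotone_realization hRR
    (fun a => (κ (π a)).map c) fun a a' haa f hf hfm hfb => by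
      rw [integral_map hc.aemeasurable hf.aestronglyMeasurable,
        integral_map hc.aemeasurable hf.aestronglyMeasurable]
      rcases (hπm haa).eq_or_lt with heq | hlt
      · rw [heq]
      · obtain ⟨M, hM⟩ := hfb
        exact hκm _ (hπS a) _ (hπS a') hlt _ (hf.comp hc) (hfm.comp hcm) ⟨M, fun b => hM _⟩
  refine ⟨E, mE, P, hP, h, hh, fun e a _ a' _ haa => hhm e a a' haa, ?_⟩
  have hlaw : ∀ᵐ a ∂γ.fst, P.map (fun e => h (a, e)) = κ a := by
    filter_upwards [hΘB0, Measure.support_mem_ae (μ := γ.fst)] with a ha haS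
    rw [hhκ, hπ a haS, Measure.map_map hcoe hc]
    have : (fun (b : Fin N → Icc (-R) R) i => (b i : ℝ)) ∘ c =ᵐ[κ a] id := by
      filter_upwards [measure_eq_zero_iff_ae_notMem.1 ha] with b hb
      exact hcΘ b (not_not.1 hb)
    rw [Measure.map_congr this, Measure.map_id]
  have hmap : Measurable fun p : ℝ × E => (p.1, h p) := measurable_fst.prodMk hh
  ext s hs
  rw [Measure.map_apply hmap hs, Measure.prod_apply (hmap hs), hκγ s hs]
  refine lintegral_congr_ae ?_
  filter_upwards [hlaw] with a ha
  have hha : Measurable fun e => h (a, e) := hh.comp measurable_prodMk_left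
  change _ = κ a (Prod.mk a ⁻¹' s)
  rw [← ha, Measure.map_apply hha (measurable_prodMk_left hs)]
  rfl
end
end
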